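/- arXiv:2203.14399 — 3 statements merged into one kernel-verified Lean document; each statement's English description precedes it below -/
import Mathlib

section
/- The q-Gaussian solves the porous medium equation (Plastino–Plastino/Tsallis–Bukman solution): let d ≥ 1 be an integer, 1 ≤ q < (d+4)/(d+2), α = 1 + d(1-q)/2, and D > 0. There exists a constant ε > 0, depending only on q and d, such that the function p(x,t) = G_q(x; 0, ε(2Dt)^{1/α} I_d) satisfies ∂p/∂t = D Δ_x (p^{2-q}) for all t > 0 and all x ∈ ℝ^d. In particular the covariance matrix of p(·,t) is ε(2Dt)^{1/α} I_d, exhibiting anomalous diffusion with exponent 1/α = 2/(2+d(1-q)). -/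
open MeasureTheory Real

/-- The real `q`-exponential. -/
noncomputable def qExp (q u : ℝ) : ℝ :=
  if q = 1 then Real.exp u
  else if 0 < 1 + (1 - q) * u then (1 + (1 - q) * u) ^ (1 / (1 - q)) else 0

/-- `π_{qd} = (∫_{ℝ^d} exp_q(-‖x‖²) dx)^{2/d}`. -/
noncomputable def piQd (q : ℝ) (d : ℕ) : ℝ :=
  (∫ x : EuclideanSpace ℝ (Fin d), qExp q (-‖x‖ ^ 2)) ^ (2 / (d : ℝ))

/-- `2_{qd} = d π_{qd}^{d/2} / ∫_{ℝ^d} ‖x‖² exp_q(-‖x‖²) dx`. -/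
noncomputable def twoQd (q : ℝ) (d : ℕ) : ℝ :=
  d * piQd q d ^ ((d : ℝ) / 2) /
    ∫ x : EuclideanSpace ℝ (Fin d), ‖x‖ ^ 2 * qExp q (-‖x‖ ^ 2)

/-- The q-Gaussian density with scalar covariance `σ²I_d`:
`G_q(x;0,σ²I_d) = exp_q(-‖x‖²/(2_{qd}σ²)) / (2_{qd}π_{qd}σ²)^{d/2}`. -/
noncomputable def GqS (q : ℝ) (d : ℕ) (σ2 : ℝ) (x : EuclideanSpace ℝ (Fin d)) : ℝ :=
  qExp q (-(‖x‖ ^ 2 / (twoQd q d * σ2))) / (twoQd q d * piQd q d * σ2) ^ ((d : ℝ) / 2)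

/-- The Laplacian on `ℝ^d` as the sum of second derivatives along the coordinate axes. -/
noncomputable def lap (d : ℕ) (f : EuclideanSpace ℝ (Fin d) → ℝ)
    (x : EuclideanSpace ℝ (Fin d)) : ℝ :=
  ∑ i : Fin d, deriv (deriv (fun s : ℝ => f (x + s • EuclideanSpace.single i (1 : ℝ)))) 0

theorem qExp_pos {q u : ℝ} (h : 0 < 1 + (1 - q) * u) : 0 < qExp q u := by
  unfold qExp
  split_ifs
  · exact Real.exp_pos u
  · exact Real.rpow_pos_of_pos h _

theorem one_add_mul_pos_of_nonpos {q u : ℝ} (hq : 1 ≤ q) (hu : u ≤ 0) :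
    0 < 1 + (1 - q) * u := by
  nlinarith [mul_nonneg_of_nonpos_of_nonpos (sub_nonpos.2 hq) hu]

theorem hasDerivAt_qExp {q u : ℝ} (h : 0 < 1 + (1 - q) * u) :
    HasDerivAt (qExp q) (qExp q u ^ q) u := by
  by_cases hq : q = 1
  · subst hq
    have : qExp 1 = Real.exp := by ext v; simp [qExp]
    rw [this, Real.rpow_one]
    exact Real.hasDerivAt_exp u
  · have hq' : 1 - q ≠ 0 := sub_ne_zero.2 (Ne.symm hq)
    have hlin : HasDerivAt (fun v : ℝ => 1 + (1 - q) * v) (1 - q) u := by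
      simpa using ((hasDerivAt_id u).const_mul (1 - q)).const_add 1
    have hpow := hlin.rpow_const (p := 1 / (1 - q)) (Or.inl h.ne')
    have heq : qExp q =ᶠ[nhds u] fun v => (1 + (1 - q) * v) ^ (1 / (1 - q)) := by
      filter_upwards [hlin.continuousAt.eventually (lt_mem_nhds h)] with v hv
      simp [qExp, hq, hv]
    refine (hpow.congr_of_eventuallyEq heq).congr_deriv ?_
    rw [heq.eq_of_nhds, ← Real.rpow_mul h.le,
      show 1 / (1 - q) * q = 1 / (1 - q) - 1 by field_simp; ring]
    field_simp

theorem hasDerivAt_qExp_rpow_two_sub {q u : ℝ} (h : 0 < 1 + (1 - q) * u) :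
    HasDerivAt (fun v => qExp q v ^ (2 - q)) ((2 - q) * qExp q u) u := by
  refine ((hasDerivAt_qExp h).rpow_const (Or.inl (qExp_pos h).ne')).congr_deriv ?_
  have hE : qExp q u ^ q * qExp q u ^ (2 - q - 1) = qExp q u := by
    rw [← Real.rpow_add (qExp_pos h), show q + (2 - q - 1) = 1 by ring, Real.rpow_one]
  linear_combination (2 - q) * hE

theorem continuous_qExp_neg_norm_sq {E : Type*} [NormedAddCommGroup E] {q : ℝ} (hq : 1 ≤ q) :
    Continuous fun x : E => qExp q (-‖x‖ ^ 2) := by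
  refine continuous_iff_continuousAt.2 fun x => ?_
  have hx : -‖x‖ ^ 2 ≤ 0 := by nlinarith [sq_nonneg ‖x‖]
  exact ContinuousAt.comp (f := fun y : E => -‖y‖ ^ 2)
    (hasDerivAt_qExp (one_add_mul_pos_of_nonpos hq hx)).continuousAt (by fun_prop)

theorem qExp_one_le {r u : ℝ} (hr : 1 < r) (hu : u ≤ 0) : qExp 1 u ≤ qExp r u := by
  have h := one_add_mul_pos_of_nonpos hr.le hu
  have hr' : 1 - r ≠ 0 := by linarith
  simp only [qExp, if_pos, if_neg hr.ne', if_pos h]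
  rw [Real.rpow_def_of_pos h, Real.exp_le_exp, mul_one_div, le_div_iff_of_neg (by linarith)]
  linarith [Real.log_le_sub_one_of_pos h]

section Integrals

variable {E : Type*} [NormedAddCommGroup E] [NormedSpace ℝ E] [FiniteDimensional ℝ E]
  [MeasurableSpace E] [BorelSpace E] (μ : Measure E) [μ.IsAddHaarMeasure]

theorem integrable_one_add_norm_sq_mul_qExp {q : ℝ} (hq : 1 ≤ q)
    (hq2 : q < ((Module.finrank ℝ E : ℝ) + 4) / ((Module.finrank ℝ E : ℝ) + 2)) :
    Integrable (fun x : E => (1 + ‖x‖ ^ 2) * qExp q (-‖x‖ ^ 2)) μ := by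
  have hd : (0 : ℝ) ≤ Module.finrank ℝ E := Nat.cast_nonneg _
  have hmeas : ∀ {r : ℝ}, 1 ≤ r →
      AEStronglyMeasurable (fun x : E => (1 + ‖x‖ ^ 2) * qExp r (-‖x‖ ^ 2)) μ := fun hr =>
    ((by fun_prop : Continuous fun x : E => 1 + ‖x‖ ^ 2).mul
      (continuous_qExp_neg_norm_sq hr)).aestronglyMeasurable
  have hneg : ∀ x : E, -‖x‖ ^ 2 ≤ 0 := fun x => by nlinarith [sq_nonneg ‖x‖]
  have key : ∀ r : ℝ, 1 < r →
      r < ((Module.finrank ℝ E : ℝ) + 4) / ((Module.finrank ℝ E : ℝ) + 2) →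
      Integrable (fun x : E => (1 + ‖x‖ ^ 2) * qExp r (-‖x‖ ^ 2)) μ := by
    intro r hr hr2
    have hr0 : 0 < r - 1 := sub_pos.2 hr
    rw [lt_div_iff₀ (by linarith)] at hr2
    have hr3 : r - 1 ≤ 1 := by nlinarith
    have hdim : (Module.finrank ℝ E : ℝ) < 2 / (r - 1) - 2 := by
      rw [lt_sub_iff_add_lt, lt_div_iff₀ hr0]; linarith
    refine ((integrable_rpow_neg_one_add_norm_sq (μ := μ) hdim).const_mul
      ((r - 1) ^ (1 / (1 - r)))).mono' (hmeas hr.le) (.of_forall fun x => ?_)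
    have hx := one_add_mul_pos_of_nonpos hr.le (hneg x)
    have h1 : 0 < 1 + ‖x‖ ^ 2 := by positivity
    rw [Real.norm_of_nonneg (mul_nonneg h1.le (qExp_pos hx).le)]
    simp only [qExp, if_neg hr.ne', if_pos hx]
    have hle : (r - 1) * (1 + ‖x‖ ^ 2) ≤ 1 + (1 - r) * -‖x‖ ^ 2 := by nlinarith
    calc (1 + ‖x‖ ^ 2) * (1 + (1 - r) * -‖x‖ ^ 2) ^ (1 / (1 - r))
        ≤ (1 + ‖x‖ ^ 2) * ((r - 1) * (1 + ‖x‖ ^ 2)) ^ (1 / (1 - r)) := by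
          refine mul_le_mul_of_nonneg_left ?_ h1.le
          exact Real.rpow_le_rpow_of_nonpos (by positivity) hle
            (div_nonpos_of_nonneg_of_nonpos zero_le_one (by linarith))
      _ = (r - 1) ^ (1 / (1 - r)) * (1 + ‖x‖ ^ 2) ^ (-(2 / (r - 1) - 2) / 2) := by
          rw [Real.mul_rpow hr0.le h1.le, mul_left_comm]
          congr 1
          nth_rewrite 1 [← Real.rpow_one (1 + ‖x‖ ^ 2)]
          rw [← Real.rpow_add h1]
          congr 1
          have : 1 - r ≠ 0 := by linarith
          field_simp
          ring
  rcases hq.eq_or_lt with rfl | hq1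
  · obtain ⟨r, hr, hr2⟩ := exists_between hq2
    refine (key r hr hr2).mono' (hmeas le_rfl) (.of_forall fun x => ?_)
    have h1 : 0 < 1 + ‖x‖ ^ 2 := by positivity
    have hx := one_add_mul_pos_of_nonpos le_rfl (hneg x)
    rw [Real.norm_of_nonneg (mul_nonneg h1.le (qExp_pos hx).le)]
    exact mul_le_mul_of_nonneg_left (qExp_one_le hr (hneg x)) h1.le
  · exact key q hq1 hq2

theorem integral_mul_qExp_pos {q : ℝ} (hq : 1 ≤ q)
    (hq2 : q < ((Module.finrank ℝ E : ℝ) + 4) / ((Module.finrank ℝ E : ℝ) + 2))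
    {w : E → ℝ} (hw : Continuous w) (hw0 : ∀ x, 0 ≤ w x) (hw1 : ∀ x, w x ≤ 1 + ‖x‖ ^ 2)
    {x₀ : E} (hx₀ : w x₀ ≠ 0) :
    0 < ∫ x : E, w x * qExp q (-‖x‖ ^ 2) ∂μ := by
  have hpos : ∀ x : E, 0 < qExp q (-‖x‖ ^ 2) := fun x =>
    qExp_pos (one_add_mul_pos_of_nonpos hq (by nlinarith [sq_nonneg ‖x‖]))
  have hcont : Continuous fun x : E => w x * qExp q (-‖x‖ ^ 2) :=
    hw.mul (continuous_qExp_neg_norm_sq hq)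
  have h0 : ∀ x, 0 ≤ w x * qExp q (-‖x‖ ^ 2) := fun x => mul_nonneg (hw0 x) (hpos x).le
  refine integral_pos_of_integrable_nonneg_nonzero hcont
    ((integrable_one_add_norm_sq_mul_qExp μ hq hq2).mono' hcont.aestronglyMeasurable
      (.of_forall fun x => ?_)) h0 (mul_ne_zero hx₀ (hpos x₀).ne')
  rw [Real.norm_of_nonneg (h0 x)]
  exact mul_le_mul_of_nonneg_right (hw1 x) (hpos x).le

end Integrals

theorem piQd_pos {q : ℝ} {d : ℕ} (hq : 1 ≤ q) (hq2 : q < ((d : ℝ) + 4) / ((d : ℝ) + 2)) :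
    0 < piQd q d := by
  refine Real.rpow_pos_of_pos ?_ _
  simpa using integral_mul_qExp_pos (volume : Measure (EuclideanSpace ℝ (Fin d))) hq
    (by simpa using hq2) (w := fun _ => 1) continuous_const (fun _ => zero_le_one)
    (fun x => by nlinarith [sq_nonneg ‖x‖]) (x₀ := 0) one_ne_zero

theorem twoQd_pos {q : ℝ} {d : ℕ} (hd : 1 ≤ d) (hq : 1 ≤ q)
    (hq2 : q < ((d : ℝ) + 4) / ((d : ℝ) + 2)) : 0 < twoQd q d := by
  have hπ := piQd_pos hq hq2
  have hd' : (0 : ℝ) < d := by exact_mod_cast hd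
  refine div_pos (mul_pos hd' (Real.rpow_pos_of_pos hπ _)) ?_
  exact integral_mul_qExp_pos (volume : Measure (EuclideanSpace ℝ (Fin d))) hq
    (by simpa using hq2) (w := fun x => ‖x‖ ^ 2) (by fun_prop) (fun x => sq_nonneg _)
    (fun x => by linarith) (x₀ := EuclideanSpace.single ⟨0, hd⟩ 1) (by simp)

theorem hasDerivAt_qExp_neg_norm_line {d : ℕ} {q B : ℝ} (hq : 1 ≤ q) (hB : 0 < B)
    (x : EuclideanSpace ℝ (Fin d)) (i : Fin d) {f : ℝ → ℝ} {f' s : ℝ}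
    (hf : 0 < 1 + (1 - q) * -(‖x + s • EuclideanSpace.single i (1 : ℝ)‖ ^ 2 / B) →
      HasDerivAt f f' (-(‖x + s • EuclideanSpace.single i (1 : ℝ)‖ ^ 2 / B))) :
    HasDerivAt (fun s : ℝ => f (-(‖x + s • EuclideanSpace.single i (1 : ℝ)‖ ^ 2 / B)))
      (f' * -((2 * x i + 2 * s) / B)) s := by
  have hnorm : ∀ s : ℝ, ‖x + s • EuclideanSpace.single i (1 : ℝ)‖ ^ 2
      = ‖x‖ ^ 2 + 2 * x i * s + s ^ 2 := by
    intro s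
    rw [norm_add_sq_real, inner_smul_right, norm_smul, EuclideanSpace.inner_single_right]
    simp
    ring
  refine (hf (one_add_mul_pos_of_nonpos hq (by rw [neg_nonpos]; positivity))).comp
    (h := fun s : ℝ => -(‖x + s • EuclideanSpace.single i (1 : ℝ)‖ ^ 2 / B)) s ?_
  simp only [hnorm]
  have h1 : HasDerivAt (fun s : ℝ => ‖x‖ ^ 2 + 2 * x i * s + s ^ 2) (2 * x i + 2 * s) s := by
    refine HasDerivAt.congr_deriv ((((hasDerivAt_id s).const_mul (2 * x i)).const_add
      (‖x‖ ^ 2)).fun_add ((hasDerivAt_id s).fun_pow 2)) ?_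
    simp
  exact (h1.div_const B).neg

theorem lap_qExp_neg_norm_sq_div_rpow {d : ℕ} {q B N : ℝ} (hq : 1 ≤ q) (hB : 0 < B) (hN : 0 < N)
    (x : EuclideanSpace ℝ (Fin d)) :
    lap d (fun y => (qExp q (-(‖y‖ ^ 2 / B)) / N) ^ (2 - q)) x =
      (2 - q) / N ^ (2 - q) * (4 / B) *
        (‖x‖ ^ 2 / B * qExp q (-(‖x‖ ^ 2 / B)) ^ q - d / 2 * qExp q (-(‖x‖ ^ 2 / B))) := by
  have hnn : ∀ y : EuclideanSpace ℝ (Fin d), 0 ≤ qExp q (-(‖y‖ ^ 2 / B)) := fun y =>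
    (qExp_pos (one_add_mul_pos_of_nonpos hq (by rw [neg_nonpos]; positivity))).le
  have hterm : ∀ i : Fin d,
      deriv (deriv (fun s : ℝ =>
        (qExp q (-(‖x + s • EuclideanSpace.single i (1 : ℝ)‖ ^ 2 / B)) / N) ^ (2 - q))) 0 =
      (2 - q) / N ^ (2 - q) * (4 / B) * (x i ^ 2 / B * qExp q (-(‖x‖ ^ 2 / B)) ^ q
        - 1 / 2 * qExp q (-(‖x‖ ^ 2 / B))) := by
    intro i
    have h1 : deriv (fun s : ℝ =>
        (qExp q (-(‖x + s • EuclideanSpace.single i (1 : ℝ)‖ ^ 2 / B)) / N) ^ (2 - q)) =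
        fun s => (2 - q) * qExp q (-(‖x + s • EuclideanSpace.single i (1 : ℝ)‖ ^ 2 / B))
          * -((2 * x i + 2 * s) / B) / N ^ (2 - q) := by
      funext s
      simp only [Real.div_rpow (hnn _) hN.le]
      exact ((hasDerivAt_qExp_neg_norm_line hq hB x i
        hasDerivAt_qExp_rpow_two_sub).div_const _).deriv
    have h2 := hasDerivAt_qExp_neg_norm_line hq hB x i (s := 0) hasDerivAt_qExp
    have h3 : HasDerivAt (fun s : ℝ => -((2 * x i + 2 * s) / B)) (-(2 / B)) 0 := by
      simpa using ((((hasDerivAt_id (0 : ℝ)).const_mul 2).const_add (2 * x i)).div_const B).fun_neg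
    rw [h1, (((h2.const_mul (2 - q)).fun_mul h3).div_const _).deriv]
    simp only [zero_smul, add_zero, mul_zero]
    field_simp
    ring
  simp only [lap, hterm]
  rw [← Finset.mul_sum, Finset.sum_sub_distrib, ← Finset.sum_mul, ← Finset.sum_div,
    EuclideanSpace.real_norm_sq_eq]
  simp only [Finset.sum_const, Finset.card_univ, Fintype.card_fin, nsmul_eq_mul]
  ring

theorem hasDerivAt_qExp_div_rpow {q a A K c σ σ' t : ℝ} {S : ℝ → ℝ} (hq : 1 ≤ q) (ha : 0 ≤ a)
    (hA : 0 < A) (hK : 0 < K) (hσ : 0 < σ) (hS : HasDerivAt S σ' t) (hSt : S t = σ) :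
    HasDerivAt (fun τ => qExp q (-(a / (A * S τ))) / (K * S τ) ^ c)
      (σ' / σ / (K * σ) ^ c * (a / (A * σ) * qExp q (-(a / (A * σ))) ^ q
        - c * qExp q (-(a / (A * σ))))) t := by
  subst hSt
  have hu : -(a / (A * S t)) ≤ 0 := by rw [neg_nonpos]; positivity
  have hE := (hasDerivAt_qExp (one_add_mul_pos_of_nonpos hq hu)).comp
    (h := fun τ => -(a / (A * S τ))) t
    (((hasDerivAt_const t a).div (hS.const_mul A) (by positivity)).neg)
  have hKS : 0 < K * S t := mul_pos hK hσ
  have hP := (hS.const_mul K).rpow_const (p := c) (Or.inl hKS.ne')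
  have hne : (K * S t) ^ c ≠ 0 := (Real.rpow_pos_of_pos hKS c).ne'
  refine (hE.div hP hne).congr_deriv ?_
  rw [Real.rpow_sub_one hKS.ne']
  simp only [Function.comp]
  field_simp
  ring

/-- the q-Gaussian solves the porous medium equation
(Plastino–Plastino / Tsallis–Bukman solution): for `1 ≤ q < (d+4)/(d+2)`,
`α = 1 + d(1-q)/2`, there is `ε > 0` depending only on `q` and `d` such that
`p(x,t) = G_q(x;0,ε(2Dt)^{1/α}I_d)` satisfies `∂p/∂t = D Δ(p^{2-q})` for all `t > 0`. -/
theorem stmt16 (d : ℕ) (hd : 1 ≤ d) (q : ℝ) (hq1 : 1 ≤ q)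
    (hq2 : q < ((d : ℝ) + 4) / ((d : ℝ) + 2))
    (α : ℝ) (hα : α = 1 + (d : ℝ) * (1 - q) / 2) :
    ∃ ε : ℝ, 0 < ε ∧ ∀ D : ℝ, 0 < D → ∀ t : ℝ, 0 < t →
      ∀ x : EuclideanSpace ℝ (Fin d),
        HasDerivAt (fun τ : ℝ => GqS q d (ε * (2 * D * τ) ^ (1 / α)) x)
          (D * lap d (fun y => GqS q d (ε * (2 * D * t) ^ (1 / α)) y ^ (2 - q)) x) t := by
  have hd' : (1 : ℝ) ≤ d := by exact_mod_cast hd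
  have hA := twoQd_pos hd hq1 hq2
  have hP := piQd_pos hq1 hq2
  rw [lt_div_iff₀ (by linarith)] at hq2
  have hα0 : 0 < α := by rw [hα]; nlinarith
  have hq0 : 0 < 2 - q := by nlinarith
  set A := twoQd q d with hAdef
  set K := A * piQd q d with hKdef
  have hK : 0 < K := mul_pos hA hP
  set M := 2 * α * (2 - q) / A * K ^ (1 - α) with hM
  have hM0 : 0 < M := by positivity
  refine ⟨M ^ (1 / α), by positivity, fun D hD t ht x => ?_⟩
  set ε := M ^ (1 / α) with hε
  have hε0 : 0 < ε := by positivity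
  set σ := ε * (2 * D * t) ^ (1 / α) with hσdef
  have hσ : 0 < σ := by positivity
  have hS : HasDerivAt (fun τ : ℝ => ε * (2 * D * τ) ^ (1 / α)) (σ / (α * t)) t := by
    have h2 : 2 * D * t ≠ 0 := by positivity
    have h1 := ((((hasDerivAt_id t).const_mul (2 * D)).rpow_const (p := 1 / α)
      (Or.inl h2)).const_mul ε)
    refine h1.congr_deriv ?_
    simp only [id, Real.rpow_sub_one h2, hσdef]
    field_simp
  have hσα : σ ^ α = M * (2 * D * t) := by
    rw [hσdef, hε, Real.mul_rpow (by positivity) (by positivity), ← Real.rpow_mul hM0.le,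
      ← Real.rpow_mul (by positivity), one_div_mul_cancel hα0.ne', Real.rpow_one, Real.rpow_one]
  have hKσ : 0 < K * σ := mul_pos hK hσ
  have hrate : (K * σ) ^ (α - 1) * σ = 4 * D * (2 - q) / A * (α * t) := by
    have h1 : (K * σ) ^ (α - 1) * σ = K ^ (α - 1) * σ ^ α := by
      rw [Real.mul_rpow hK.le hσ.le, Real.rpow_sub_one hσ.ne']
      field_simp
    have h2 : K ^ (α - 1) * K ^ (1 - α) = 1 := by
      rw [← Real.rpow_add hK, show α - 1 + (1 - α) = 0 by ring, Real.rpow_zero]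
    rw [h1, hσα, hM]
    linear_combination 2 * α * (2 - q) / A * (2 * D * t) * h2
  have hpow : ((K * σ) ^ ((d : ℝ) / 2)) ^ (2 - q)
      = (K * σ) ^ ((d : ℝ) / 2) * (K * σ) ^ (α - 1) := by
    rw [← Real.rpow_mul hKσ.le, ← Real.rpow_add hKσ]
    congr 1
    rw [hα]; ring
  have hC : 0 < (K * σ) ^ ((d : ℝ) / 2) := by positivity
  have hR : 0 < (K * σ) ^ (α - 1) := by positivity
  simp only [GqS, ← hAdef, ← hKdef]
  rw [lap_qExp_neg_norm_sq_div_rpow hq1 (mul_pos hA hσ) hC]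
  refine (hasDerivAt_qExp_div_rpow hq1 (sq_nonneg ‖x‖) hA hK hσ hS rfl).congr_deriv ?_
  have hcoef : σ / (α * t) / σ = D * (2 - q) / (K * σ) ^ (α - 1) * (4 / (A * σ)) := by
    field_simp at hrate ⊢
    linear_combination hrate
  rw [hpow, hcoef]
  field_simp
end

section
/- Solution of the O'Shaughnessy–Procaccia equation for diffusion on fractals: let d > 0, η > 0, and D > 0 be real numbers, and define p(r,t) = (2η / (Γ(d/(2η)) (4η²Dt)^{d/(2η)})) · exp(−r^{2η}/(4η²Dt)) for r > 0, t > 0, where Γ is the Gamma function. Then (i) p satisfies the O'Shaughnessy–Procaccia equation ∂p/∂t = (D/r^{d-1}) ∂/∂r ( r^{d+1-2η} ∂p/∂r ) for all r > 0, t > 0, and (ii) for every t > 0, ∫₀^∞ p(r,t) r^{d-1} dr = 1. -/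
open MeasureTheory Real

/-- The O'Shaughnessy–Procaccia radial density
`p(r,t) = (2η/(Γ(d/(2η))(4η²Dt)^{d/(2η)})) exp(-r^{2η}/(4η²Dt))`. -/
noncomputable def OSP (d η D : ℝ) (r t : ℝ) : ℝ :=
  2 * η / (Real.Gamma (d / (2 * η)) * (4 * η ^ 2 * D * t) ^ (d / (2 * η))) *
    Real.exp (-(r ^ (2 * η) / (4 * η ^ 2 * D * t)))

lemma OSP_hasDerivAt_radius (d η D t : ℝ) {r : ℝ} (hr : 0 < r) :
    HasDerivAt (fun ρ : ℝ => OSP d η D ρ t)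
      (-(2 * η / (4 * η ^ 2 * D * t)) * r ^ (2 * η - 1) * OSP d η D r t) r := by
  have h := (((hasDerivAt_rpow_const (p := 2 * η) (Or.inl hr.ne')).div_const
    (4 * η ^ 2 * D * t)).neg.exp).const_mul
      (2 * η / (Real.Gamma (d / (2 * η)) * (4 * η ^ 2 * D * t) ^ (d / (2 * η))))
  refine h.congr_deriv ?_
  simp only [OSP, Pi.neg_apply]
  ring

lemma OSP_hasDerivAt_flux (d η D t : ℝ) {r : ℝ} (hr : 0 < r) :
    HasDerivAt (fun ρ : ℝ => ρ ^ (d + 1 - 2 * η) * deriv (fun ρ' : ℝ => OSP d η D ρ' t) ρ)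
      (-(2 * η / (4 * η ^ 2 * D * t)) * r ^ (d - 1) *
        (d - 2 * η / (4 * η ^ 2 * D * t) * r ^ (2 * η)) * OSP d η D r t) r := by
  have h := ((hasDerivAt_rpow_const (p := d) (Or.inl hr.ne')).mul
    (OSP_hasDerivAt_radius d η D t hr)).const_mul (-(2 * η / (4 * η ^ 2 * D * t)))
  have hflux : (fun ρ : ℝ => ρ ^ (d + 1 - 2 * η) * deriv (fun ρ' : ℝ => OSP d η D ρ' t) ρ)
      =ᶠ[nhds r] fun ρ => -(2 * η / (4 * η ^ 2 * D * t)) * (ρ ^ d * OSP d η D ρ t) := by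
    filter_upwards [lt_mem_nhds hr] with ρ hρ
    have hpow : ρ ^ d = ρ ^ (d + 1 - 2 * η) * ρ ^ (2 * η - 1) := by
      rw [← rpow_add hρ]; congr 1; ring
    rw [(OSP_hasDerivAt_radius d η D t hρ).deriv, hpow]
    ring
  refine (h.congr_of_eventuallyEq hflux).congr_deriv ?_
  have hpow : r ^ d * r ^ (2 * η - 1) = r ^ (d - 1) * r ^ (2 * η) := by
    rw [← rpow_add hr, ← rpow_add hr]; congr 1; ring
  linear_combination (2 * η / (4 * η ^ 2 * D * t)) ^ 2 * OSP d η D r t * hpow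

lemma OSP_hasDerivAt_time (d r : ℝ) {η D t : ℝ} (hd : 0 < d) (hη : 0 < η) (hD : 0 < D)
    (ht : 0 < t) :
    HasDerivAt (fun τ : ℝ => OSP d η D r τ)
      ((-(d / (2 * η)) / t + r ^ (2 * η) / (4 * η ^ 2 * D * t ^ 2)) * OSP d η D r t) t := by
  have hc : 0 < 4 * η ^ 2 * D * t := by positivity
  have hG : 0 < Real.Gamma (d / (2 * η)) := Real.Gamma_pos_of_pos (by positivity)
  have hP : 0 < (4 * η ^ 2 * D * t) ^ (d / (2 * η)) := rpow_pos_of_pos hc _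
  have hs : HasDerivAt (fun τ : ℝ => 4 * η ^ 2 * D * τ) (4 * η ^ 2 * D) t := by
    simpa using (hasDerivAt_id t).const_mul (4 * η ^ 2 * D)
  have hpow := (hs.rpow_const (p := d / (2 * η)) (Or.inl hc.ne')).const_mul
    (Real.Gamma (d / (2 * η)))
  have h := ((hasDerivAt_const t (2 * η)).div hpow (by positivity)).mul
    (((hasDerivAt_const t (r ^ (2 * η))).div hs hc.ne').neg.exp)
  refine h.congr_deriv ?_
  simp only [OSP, Pi.neg_apply, Pi.div_apply]
  rw [rpow_sub_one hc.ne']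
  generalize (4 * η ^ 2 * D * t) ^ (d / (2 * η)) = P at *
  generalize Real.Gamma (d / (2 * η)) = G at *
  generalize rexp _ = E
  field_simp
  ring

lemma integral_OSP_mul_rpow {d η D t : ℝ} (hd : 0 < d) (hη : 0 < η) (hD : 0 < D) (ht : 0 < t) :
    (∫ r in Set.Ioi (0 : ℝ), OSP d η D r t * r ^ (d - 1)) = 1 := by
  have hc : 0 < 4 * η ^ 2 * D * t := by positivity
  have hG : 0 < Real.Gamma (d / (2 * η)) := Real.Gamma_pos_of_pos (by positivity)
  have hP : 0 < (4 * η ^ 2 * D * t) ^ (d / (2 * η)) := rpow_pos_of_pos hc _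
  have hfun : ∀ r : ℝ, OSP d η D r t * r ^ (d - 1) =
      2 * η / (Real.Gamma (d / (2 * η)) * (4 * η ^ 2 * D * t) ^ (d / (2 * η))) *
        (r ^ (d - 1) * rexp (-(4 * η ^ 2 * D * t)⁻¹ * r ^ (2 * η))) := by
    intro r
    rw [OSP, show -(r ^ (2 * η) / (4 * η ^ 2 * D * t)) =
      -(4 * η ^ 2 * D * t)⁻¹ * r ^ (2 * η) by ring]
    ring
  simp_rw [hfun]
  rw [integral_const_mul, integral_rpow_mul_exp_neg_mul_rpow (by positivity) (by linarith)
    (inv_pos.mpr hc), sub_add_cancel, neg_div, rpow_neg (inv_pos.mpr hc).le, inv_rpow hc.le,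
    inv_inv]
  field_simp

/-- the density `OSP` solves the O'Shaughnessy–Procaccia equation for
diffusion on fractals: (i) `∂p/∂t = (D/r^{d-1}) ∂/∂r (r^{d+1-2η} ∂p/∂r)` for `r, t > 0`;
(ii) `∫₀^∞ p(r,t) r^{d-1} dr = 1` for `t > 0`. -/
theorem stmt18 (d η D : ℝ) (hd : 0 < d) (hη : 0 < η) (hD : 0 < D) :
    (∀ r t : ℝ, 0 < r → 0 < t →
      HasDerivAt (fun τ : ℝ => OSP d η D r τ)
        (D / r ^ (d - 1) *
          deriv (fun ρ : ℝ => ρ ^ (d + 1 - 2 * η) * deriv (fun ρ' : ℝ => OSP d η D ρ' t) ρ) r)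
        t) ∧
    (∀ t : ℝ, 0 < t → (∫ r in Set.Ioi (0 : ℝ), OSP d η D r t * r ^ (d - 1)) = 1) := by
  refine ⟨fun r t hr ht => ?_, fun t ht => integral_OSP_mul_rpow hd hη hD ht⟩
  rw [(OSP_hasDerivAt_flux d η D t hr).deriv]
  refine (OSP_hasDerivAt_time d r hd hη hD ht).congr_deriv ?_
  have hr' : 0 < r ^ (d - 1) := rpow_pos_of_pos hr _
  field_simp
  ring
end

section
/- Covariance of the nonextensive Ornstein–Uhlenbeck process: let α, γ, D, ε > 0 be real numbers and define Σ(t) = ε [ (D/(αγ)) (1 − e^{−2αγt}) ]^{1/α} for t > 0. Then (i) Σ is differentiable on (0,∞) and satisfies the generalized Lyapunov equation dΣ/dt = −2γ Σ(t) + (2 ε^α D / α) Σ(t)^{1−α} for all t > 0; (ii) lim_{t→∞} Σ(t) = Σ_eq where Σ_eq = ε (D/(αγ))^{1/α}; and (iii) Σ_eq is the unique positive real number satisfying −2γ Σ_eq + (2 ε^α D / α) Σ_eq^{1−α} = 0. -/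
open Real Filter

theorem rpow_mul_rpow_one_sub {α ε u : ℝ} (hα : α ≠ 0) (hε : 0 < ε) (hu : 0 < u) :
    ε ^ α * (ε * u ^ (1 / α)) ^ (1 - α) = ε * u ^ (1 / α - 1) := by
  rw [Real.mul_rpow hε.le (Real.rpow_nonneg hu.le _), ← Real.rpow_mul hu.le, ← mul_assoc,
    ← Real.rpow_add hε]
  have h : 1 / α * (1 - α) = 1 / α - 1 := by field_simp
  rw [h, add_sub_cancel, Real.rpow_one]

theorem eq_mul_rpow_one_div_iff {α ε u S : ℝ} (hα : α ≠ 0) (hε : 0 < ε) (hu : 0 < u)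
    (hS : 0 < S) : S = ε * u ^ (1 / α) ↔ S ^ α = ε ^ α * u := by
  have hr : 0 < ε * u ^ (1 / α) := mul_pos hε (Real.rpow_pos_of_pos hu _)
  rw [← Real.rpow_left_inj hS.le hr.le hα,
    Real.mul_rpow hε.le (Real.rpow_nonneg hu.le _), ← Real.rpow_mul hu.le,
    one_div_mul_cancel hα, Real.rpow_one]

/-- covariance of the nonextensive Ornstein–Uhlenbeck process:
`Σ(t) = ε[(D/(αγ))(1 - e^{-2αγt})]^{1/α}` satisfies
(i) the generalized Lyapunov equation `dΣ/dt = -2γΣ + (2ε^αD/α)Σ^{1-α}` on `(0,∞)`;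
(ii) `Σ(t) → Σ_eq = ε(D/(αγ))^{1/α}` as `t → ∞`;
(iii) `Σ_eq` is the unique positive root of `-2γS + (2ε^αD/α)S^{1-α} = 0`. -/
theorem stmt19 (α γ D ε : ℝ) (hα : 0 < α) (hγ : 0 < γ) (hD : 0 < D) (hε : 0 < ε) :
    (∀ t : ℝ, 0 < t →
      HasDerivAt (fun τ : ℝ => ε * (D / (α * γ) * (1 - Real.exp (-2 * α * γ * τ))) ^ (1 / α))
        (-2 * γ * (ε * (D / (α * γ) * (1 - Real.exp (-2 * α * γ * t))) ^ (1 / α)) +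
          2 * ε ^ α * D / α *
            (ε * (D / (α * γ) * (1 - Real.exp (-2 * α * γ * t))) ^ (1 / α)) ^ (1 - α)) t) ∧
    Tendsto (fun t : ℝ => ε * (D / (α * γ) * (1 - Real.exp (-2 * α * γ * t))) ^ (1 / α))
      atTop (nhds (ε * (D / (α * γ)) ^ (1 / α))) ∧
    (∀ S : ℝ, 0 < S →
      ((-2 * γ * S + 2 * ε ^ α * D / α * S ^ (1 - α) = 0) ↔
        S = ε * (D / (α * γ)) ^ (1 / α))) := by
  refine ⟨fun t ht => ?_, ?_, fun S hS => ?_⟩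
  · have hE : Real.exp (-2 * α * γ * t) < 1 := by
      rw [Real.exp_lt_one_iff]
      have : 0 < α * γ * t := by positivity
      linarith
    have hu : 0 < D / (α * γ) * (1 - Real.exp (-2 * α * γ * t)) :=
      mul_pos (by positivity) (sub_pos.2 hE)
    have hd := ((((((hasDerivAt_id t).const_mul (-2 * α * γ)).exp).const_sub 1).const_mul
      (D / (α * γ))).rpow_const (p := 1 / α) (Or.inl hu.ne')).const_mul ε
    refine hd.congr_deriv ?_
    have key := rpow_mul_rpow_one_sub hα.ne' hε hu
    have hsplit : (D / (α * γ) * (1 - Real.exp (-2 * α * γ * t))) ^ (1 / α) =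
        (D / (α * γ) * (1 - Real.exp (-2 * α * γ * t))) ^ (1 / α - 1) *
          (D / (α * γ) * (1 - Real.exp (-2 * α * γ * t))) := by
      rw [Real.rpow_sub_one hu.ne', div_mul_cancel₀ _ hu.ne']
    rw [show ∀ x : ℝ, 2 * ε ^ α * D / α * x = 2 * D / α * (ε ^ α * x) from fun x => by ring,
      key, hsplit]
    simp only [id]
    generalize (D / (α * γ) * (1 - Real.exp (-2 * α * γ * t))) ^ (1 / α - 1) = w
    field_simp
    ring
  · have hlin : Tendsto (fun t : ℝ => -2 * α * γ * t) atTop atBot :=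
      tendsto_id.const_mul_atTop_of_neg (by nlinarith [mul_pos hα hγ])
    have hu : Tendsto (fun t : ℝ => D / (α * γ) * (1 - Real.exp (-2 * α * γ * t))) atTop
        (nhds (D / (α * γ))) := by
      simpa using ((Real.tendsto_exp_atBot.comp hlin).const_sub 1).const_mul (D / (α * γ))
    exact (hu.rpow_const (Or.inr (by positivity))).const_mul ε
  · rw [eq_mul_rpow_one_div_iff hα.ne' hε (by positivity) hS, Real.rpow_sub hS, Real.rpow_one]
    have hSα : 0 < S ^ α := Real.rpow_pos_of_pos hS α
    have hfac : -2 * γ * S + 2 * ε ^ α * D / α * (S / S ^ α) =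
        2 * γ * S / S ^ α * (ε ^ α * (D / (α * γ)) - S ^ α) := by
      field_simp
      ring
    rw [hfac, mul_eq_zero, or_iff_right (by positivity), sub_eq_zero, eq_comm]
end
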